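/- Let 1 ≤ p ≤ ∞ and 0 < q ≤ ∞. Let u : ℝ → [0,∞] be even with u non-increasing in |x|, and let v : ℤ → (0,∞] be even (v_n = v_{−n}) with v_n non-decreasing in |n|. Let C₁₀ be the smallest constant such that ( ∫_{−1/2}^{1/2} | u(x) Σ_{n∈ℤ} f(n) e^{2πinx} |^q dx )^{1/q} ≤ C₁₀ ( Σ_{n∈ℤ} |v_n f(n)|^p )^{1/p} for every summable sequence f : ℤ → ℂ, and let C₁₂ be the smallest constant such that ( ∫_{−1/2}^{1/2} |u(ξ) f̂(ξ)|^q dξ )^{1/q} ≤ C₁₂ ( ∫_ℝ |ṽ(x) f(x)|^p dx )^{1/p} for every f ∈ L¹(ℝ), where ṽ(x) = Σ_{n∈ℤ} v_n · 1_{[n−1/2, n+1/2]}(x). Then C₁₀ ≈ C₁₂ with implied constants depending only on p and q. -/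

import Mathlib

open MeasureTheory ENNReal Set

noncomputable section

/-- `enn f x = |f x|` as an extended nonnegative real number. -/
def enn {α : Type*} (f : α → ℂ) : α → ℝ≥0∞ := fun x => ENNReal.ofReal ‖f x‖

/-- The Fourier transform on `ℝ`. -/
def FT1 (g : ℝ → ℂ) (ξ : ℝ) : ℂ :=
  ∫ x : ℝ, Complex.exp (((-2 * Real.pi * (x * ξ) : ℝ) : ℂ) * Complex.I) * g x

/-- The Fourier series `x ↦ ∑_{n ∈ ℤ} f(n) e^{2πinx}` of a sequence `f`. -/
def FSeries (f : ℤ → ℂ) (x : ℝ) : ℂ :=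
  ∑' n : ℤ, f n * Complex.exp (((2 * Real.pi * ((n : ℝ) * x) : ℝ) : ℂ) * Complex.I)

/-- `(∫_{-1/2}^{1/2} |u·g|^q)^{1/q}`, with the essential supremum convention at `q = ∞`. -/
def halfNorm (u : ℝ → ℝ≥0∞) (q : ℝ≥0∞) (g : ℝ → ℂ) : ℝ≥0∞ :=
  if q = ∞ then
    essSup (fun x => u x * enn g x) (volume.restrict (Icc (-(1/2) : ℝ) (1/2)))
  else (∫⁻ x in Icc (-(1/2) : ℝ) (1/2), (u x * enn g x) ^ q.toReal) ^ (1 / q.toReal)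

/-- The weighted `ℓ^p` norm `(∑_n |v_n f(n)|^p)^{1/p}` (sup convention at `p = ∞`). -/
def seqNorm (v : ℤ → ℝ≥0∞) (p : ℝ≥0∞) (f : ℤ → ℂ) : ℝ≥0∞ :=
  if p = ∞ then ⨆ n : ℤ, v n * enn f n
  else (∑' n : ℤ, (v n * enn f n) ^ p.toReal) ^ (1 / p.toReal)

/-- The step weight `ṽ(x) = ∑_{n ∈ ℤ} v_n · 1_{[n-1/2, n+1/2]}(x)`. -/
def vtilde (v : ℤ → ℝ≥0∞) (x : ℝ) : ℝ≥0∞ :=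
  ∑' n : ℤ, Set.indicator (Icc ((n : ℝ) - 1/2) ((n : ℝ) + 1/2)) (fun _ => v n) x

/-- The weighted `L^p(ℝ)` norm `(∫_ℝ |ṽ g|^p)^{1/p}` (essential sup convention at `p = ∞`). -/
def wNormR (w : ℝ → ℝ≥0∞) (p : ℝ≥0∞) (g : ℝ → ℂ) : ℝ≥0∞ :=
  if p = ∞ then essSup (fun x => w x * enn g x) volume
  else (∫⁻ x, (w x * enn g x) ^ p.toReal) ^ (1 / p.toReal)

theorem enn_eq_enorm {α : Type*} (f : α → ℂ) (x : α) : enn f x = ‖f x‖ₑ := ofReal_norm (f x)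

/-- The unit cell of the real numbers that round to `n`. -/
def cell (n : ℤ) : Set ℝ := Ico ((n : ℝ) - 1/2) ((n : ℝ) + 1/2)

theorem mem_cell {n : ℤ} {x : ℝ} : x ∈ cell n ↔ round x = n := round_eq_iff.symm

theorem measurableSet_cell (n : ℤ) : MeasurableSet (cell n) := measurableSet_Ico

theorem pairwise_disjoint_cell : Pairwise (Function.onFun Disjoint cell) := fun _ _ hmn =>
  Set.disjoint_left.2 fun _ hm hn => hmn ((mem_cell.1 hm).symm.trans (mem_cell.1 hn))

theorem iUnion_cell : ⋃ n, cell n = univ :=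
  eq_univ_of_forall fun x => mem_iUnion.2 ⟨round x, mem_cell.2 rfl⟩

theorem volume_cell (n : ℤ) : volume (cell n) = 1 := by
  rw [cell, Real.volume_Ico]; norm_num

theorem measurable_round_real : Measurable (round : ℝ → ℤ) := by
  have : (round : ℝ → ℤ) = fun x => ⌊x + 1 / 2⌋ := funext round_eq
  rw [this]
  fun_prop

theorem lintegral_eq_tsum_cell (F : ℝ → ℝ≥0∞) : ∫⁻ x, F x = ∑' n, ∫⁻ x in cell n, F x := by
  rw [← lintegral_iUnion measurableSet_cell pairwise_disjoint_cell, iUnion_cell, setLIntegral_univ]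

theorem hasSum_integral_cell {h : ℝ → ℂ} (hh : Integrable h) :
    HasSum (fun n => ∫ x in cell n, h x) (∫ x, h x) := by
  have := hasSum_integral_iUnion (f := h) measurableSet_cell pairwise_disjoint_cell
    hh.integrableOn
  rwa [iUnion_cell, setIntegral_univ] at this

theorem summable_norm_integral_cell {h : ℝ → ℂ} (hh : Integrable h) :
    Summable fun n : ℤ => ‖∫ x in cell n, h x‖ := by
  have := hasSum_integral_iUnion (f := fun x => ‖h x‖) measurableSet_cell pairwise_disjoint_cell
    hh.norm.integrableOn
  exact this.summable.of_nonneg_of_le (fun _ => norm_nonneg _)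
    fun _ => norm_integral_le_integral_norm _

theorem norm_cexp_ofReal_mul_I_mul (a : ℝ) (z : ℂ) :
    ‖Complex.exp ((a : ℂ) * Complex.I) * z‖ = ‖z‖ := by
  rw [norm_mul, Complex.norm_exp_ofReal_mul_I, one_mul]

theorem integrable_cexp_mul {φ : ℝ → ℝ} (hφ : Measurable φ) {h : ℝ → ℂ} (hh : Integrable h) :
    Integrable fun x => Complex.exp ((φ x : ℂ) * Complex.I) * h x := by
  refine hh.mono (AEStronglyMeasurable.mul (by fun_prop) hh.1) (ae_of_all _ fun x => ?_)
  rw [norm_cexp_ofReal_mul_I_mul]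

theorem measurable_round_cast : Measurable fun x : ℝ => (round x : ℝ) :=
  (measurable_from_top (f := fun n : ℤ => (n : ℝ))).comp measurable_round_real

theorem FSeries_integral_cell {h : ℝ → ℂ} (hh : Integrable h) (ξ : ℝ) :
    FSeries (fun n => ∫ x in cell (-n), h x) ξ =
      ∫ x, Complex.exp (((-2 * Real.pi * (round x * ξ) : ℝ) : ℂ) * Complex.I) * h x := by
  have hr := measurable_round_cast
  have hs := hasSum_integral_cell
    (integrable_cexp_mul (φ := fun x => -2 * Real.pi * (round x * ξ)) (by fun_prop) hh)
  rw [← hs.tsum_eq, ← (Equiv.neg ℤ).tsum_eq, FSeries]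
  refine tsum_congr fun n => ?_
  have : ∀ x ∈ cell (-n),
      Complex.exp (((-2 * Real.pi * (round x * ξ) : ℝ) : ℂ) * Complex.I) * h x =
      Complex.exp (((2 * Real.pi * (n * ξ) : ℝ) : ℂ) * Complex.I) * h x := fun x hx => by
    rw [mem_cell.1 hx]
    push_cast
    ring_nf
  rw [Equiv.neg_apply, setIntegral_congr_fun (measurableSet_cell _) this, integral_const_mul,
    mul_comm]

theorem measurable_FSeries {f : ℤ → ℂ} (hf : Summable fun n => ‖f n‖) : Measurable (FSeries f) := by
  refine (continuous_tsum (fun n => by fun_prop) hf fun n x => ?_).measurable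
  rw [mul_comm, norm_cexp_ofReal_mul_I_mul]

theorem measurable_of_even_antitoneOn {u u₀ : ℝ → ℝ≥0∞} (h₀ : AntitoneOn u₀ (Ici 0))
    (hu : ∀ x, u x = u₀ |x|) : Measurable u := by
  have h : Antitone fun y => u₀ (max y 0) := fun x y hxy =>
    h₀ (mem_Ici.2 (le_max_right _ _)) (mem_Ici.2 (le_max_right _ _)) (max_le_max_right _ hxy)
  have : u = (fun y => u₀ (max y 0)) ∘ fun x => |x| := by
    ext x
    simp [hu]
  rw [this]
  exact h.measurable.comp (by fun_prop)

theorem mul_enorm_le_iSup {u F M : ℝ≥0∞} {G : ℕ → ℝ≥0∞} (h : F ≤ M * ∑' k, 4⁻¹ ^ k * G k) :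
    u * F ≤ 2 * M * ⨆ k, 2⁻¹ ^ k * (u * G k) := by
  have h4 : (4⁻¹ : ℝ≥0∞) = 2⁻¹ * 2⁻¹ := by
    rw [← ENNReal.mul_inv (by simp) (by simp)]; norm_num
  calc u * F ≤ u * (M * ∑' k, 4⁻¹ ^ k * G k) := by gcongr
    _ = M * ∑' k, 2⁻¹ ^ k * (2⁻¹ ^ k * (u * G k)) := by
      rw [mul_left_comm, ← ENNReal.tsum_mul_left]
      congr 2 with k
      rw [h4, mul_pow]
      ring
    _ ≤ M * ∑' k, 2⁻¹ ^ k * ⨆ k, 2⁻¹ ^ k * (u * G k) := by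
      gcongr with k
      exact le_iSup (fun k => 2⁻¹ ^ k * (u * G k)) k
    _ = 2 * M * ⨆ k, 2⁻¹ ^ k * (u * G k) := by
      rw [ENNReal.tsum_mul_right, ENNReal.tsum_geometric, ENNReal.one_sub_inv_two, inv_inv]
      ring

/-- Quasi-norm summation: a geometrically dominated series is controlled in `halfNorm`
by a uniform bound on its terms, for every exponent `0 < q ≤ ∞`. -/
theorem exists_halfNorm_series_bound {q : ℝ≥0∞} (hq : 0 < q) {M : ℝ≥0∞} (hM : M < ∞) :
    ∃ K : ℝ≥0∞, K < ∞ ∧ ∀ (u : ℝ → ℝ≥0∞) (F : ℝ → ℂ) (G : ℕ → ℝ → ℂ) (B : ℝ≥0∞),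
      Measurable u → (∀ k, Measurable (G k)) →
      (∀ ξ ∈ Icc (-(1/2) : ℝ) (1/2), ‖F ξ‖ₑ ≤ M * ∑' k, 4⁻¹ ^ k * ‖G k ξ‖ₑ) →
      (∀ k, halfNorm u q (G k) ≤ B) → halfNorm u q F ≤ K * B := by
  by_cases hqt : q = ∞
  · refine ⟨2 * M, by finiteness, fun u F G B _ _ hF hB => ?_⟩
    simp only [halfNorm, hqt, if_true, enn_eq_enorm] at hB ⊢
    refine essSup_le_of_ae_le _ ?_
    have hG : ∀ᵐ x ∂volume.restrict (Icc (-(1/2) : ℝ) (1/2)), ∀ k, u x * ‖G k x‖ₑ ≤ B :=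
      ae_all_iff.2 fun k => (ENNReal.ae_le_essSup _).mono fun x hx => hx.trans (hB k)
    filter_upwards [hG, ae_restrict_mem measurableSet_Icc] with x hx hxI
    refine (mul_enorm_le_iSup (hF x hxI)).trans ?_
    gcongr
    refine iSup_le fun k => ?_
    calc 2⁻¹ ^ k * (u x * ‖G k x‖ₑ) ≤ 1 * B := by
          gcongr
          · exact pow_le_one₀ (by simp) (by simp)
          · exact hx k
      _ = B := one_mul B
  · set r := q.toReal with hr
    have hr0 : 0 < r := ENNReal.toReal_pos hq.ne' hqt
    have hgeo : (2⁻¹ : ℝ≥0∞) ^ r < 1 := ENNReal.rpow_lt_one (by simp) hr0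
    refine ⟨2 * M * ((1 - 2⁻¹ ^ r)⁻¹) ^ (1 / r), ?_, fun u F G B hu hG hF hB => ?_⟩
    · have : (1 - (2⁻¹ : ℝ≥0∞) ^ r)⁻¹ ≠ ∞ := ENNReal.inv_ne_top.2 (tsub_pos_of_lt hgeo).ne'
      have := ENNReal.rpow_ne_top_of_nonneg (y := 1 / r) (by positivity) this
      finiteness
    simp only [halfNorm, hqt, if_false, enn_eq_enorm, ← hr] at hB ⊢
    have hB' : ∀ k, ∫⁻ x in Icc (-(1/2) : ℝ) (1/2), (u x * ‖G k x‖ₑ) ^ r ≤ B ^ r := fun k => by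
      rw [← ENNReal.rpow_inv_le_iff hr0, ← one_div]
      exact hB k
    rw [one_div r, ENNReal.rpow_inv_le_iff hr0, ENNReal.mul_rpow_of_nonneg _ _ hr0.le,
      ENNReal.mul_rpow_of_nonneg _ _ hr0.le, ENNReal.rpow_inv_rpow hr0.ne']
    calc ∫⁻ x in Icc (-(1/2) : ℝ) (1/2), (u x * ‖F x‖ₑ) ^ r
        ≤ ∫⁻ x in Icc (-(1/2) : ℝ) (1/2),
            (2 * M) ^ r * ∑' k, (2⁻¹ ^ r) ^ k * (u x * ‖G k x‖ₑ) ^ r := by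
          refine setLIntegral_mono' measurableSet_Icc fun x hx => ?_
          refine (ENNReal.rpow_le_rpow (mul_enorm_le_iSup (hF x hx)) hr0.le).trans ?_
          rw [ENNReal.mul_rpow_of_nonneg _ _ hr0.le]
          gcongr
          rw [← ENNReal.le_rpow_inv_iff hr0]
          refine iSup_le fun k => ?_
          rw [ENNReal.le_rpow_inv_iff hr0, ENNReal.mul_rpow_of_nonneg _ _ hr0.le]
          have hk : ((2⁻¹ : ℝ≥0∞) ^ k) ^ r = (2⁻¹ ^ r) ^ k := by
            rw [← ENNReal.rpow_natCast, ← ENNReal.rpow_natCast, ← ENNReal.rpow_mul,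
              ← ENNReal.rpow_mul, mul_comm]
          rw [hk]
          exact ENNReal.le_tsum k
      _ = (2 * M) ^ r * ∑' k, (2⁻¹ ^ r) ^ k *
            ∫⁻ x in Icc (-(1/2) : ℝ) (1/2), (u x * ‖G k x‖ₑ) ^ r := by
          rw [lintegral_const_mul _ (by fun_prop), lintegral_tsum (by fun_prop)]
          congr 2 with k
          rw [lintegral_const_mul _ (by fun_prop)]
      _ ≤ (2 * M) ^ r * ∑' k, (2⁻¹ ^ r) ^ k * B ^ r := by
          gcongr with k
          exact hB' k
      _ = (2 * M) ^ r * (1 - 2⁻¹ ^ r)⁻¹ * B ^ r := by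
          rw [ENNReal.tsum_mul_right, ENNReal.tsum_geometric, mul_assoc]

theorem vtilde_ae (v : ℤ → ℝ≥0∞) : ∀ᵐ x : ℝ, vtilde v x = v (round x) := by
  have hc : (range fun n : ℤ => (n : ℝ) - 1/2).Countable := countable_range _
  filter_upwards [hc.ae_notMem volume] with x hx
  have hmem : x ∈ cell (round x) := mem_cell.2 rfl
  rw [vtilde, tsum_eq_single (round x), indicator_of_mem (Ico_subset_Icc_self hmem)]
  intro m hm
  refine indicator_of_notMem (fun hI => hm ?_) _
  refine (mem_cell.1 (⟨hI.1, lt_of_le_of_ne hI.2 fun h => hx ⟨m + 1, ?_⟩⟩ : x ∈ cell m)).symm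
  push_cast
  linarith

theorem seqNorm_integral_cell_le {p : ℝ≥0∞} (hp : 1 ≤ p) {v : ℤ → ℝ≥0∞}
    (hv : ∀ n, v (-n) = v n) {g h : ℝ → ℂ} (hg : Measurable g) (hhg : ∀ x, ‖h x‖ ≤ ‖g x‖) :
    seqNorm v p (fun n => ∫ x in cell (-n), h x) ≤ wNormR (vtilde v) p g := by
  have hle : ∀ n, ‖∫ x in cell n, h x‖ₑ ≤ ∫⁻ x in cell n, ‖g x‖ₑ := fun n =>
    (enorm_integral_le_lintegral_enorm _).trans
      (lintegral_mono fun x => enorm_le_iff_norm_le.2 (hhg x))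
  by_cases hpt : p = ∞
  · simp only [seqNorm, wNormR, hpt, if_true, enn_eq_enorm]
    refine iSup_le fun n => ?_
    rw [← hv n]
    set S := essSup (fun x => vtilde v x * ‖g x‖ₑ) volume
    calc v (-n) * ‖∫ x in cell (-n), h x‖ₑ
        ≤ v (-n) * ∫⁻ x in cell (-n), ‖g x‖ₑ := by gcongr; exact hle _
      _ = ∫⁻ x in cell (-n), v (-n) * ‖g x‖ₑ := (lintegral_const_mul _ (by fun_prop)).symm
      _ ≤ ∫⁻ x in cell (-n), S := by
          refine lintegral_mono_ae ?_
          filter_upwards [ae_restrict_mem (measurableSet_cell _),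
            ae_restrict_of_ae (vtilde_ae v), ae_restrict_of_ae
              (ENNReal.ae_le_essSup fun x => vtilde v x * ‖g x‖ₑ)] with x hx hx' hx''
          rwa [hx', mem_cell.1 hx] at hx''
      _ = S := by rw [setLIntegral_const, volume_cell, mul_one]
  · have hr1 : 1 ≤ p.toReal := by
      simpa using ENNReal.toReal_mono hpt hp
    simp only [seqNorm, wNormR, hpt, if_false, enn_eq_enorm]
    set r := p.toReal
    have hr0 : 0 < r := by linarith
    gcongr
    rw [lintegral_eq_tsum_cell, ← (Equiv.neg ℤ).tsum_eq]
    refine ENNReal.tsum_le_tsum fun n => ?_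
    have : IsProbabilityMeasure (volume.restrict (cell n)) :=
      ⟨by rw [Measure.restrict_apply_univ, volume_cell]⟩
    have hH := eLpNorm'_le_eLpNorm'_of_exponent_le one_pos hr1 (volume.restrict (cell n))
      hg.aestronglyMeasurable
    simp only [eLpNorm', ENNReal.rpow_one, div_one] at hH
    rw [one_div, ENNReal.le_rpow_inv_iff hr0] at hH
    calc (v (Equiv.neg ℤ n) * ‖∫ x in cell (-(Equiv.neg ℤ n)), h x‖ₑ) ^ r
        = (v n * ‖∫ x in cell n, h x‖ₑ) ^ r := by rw [Equiv.neg_apply, neg_neg, hv]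
      _ ≤ (v n * ∫⁻ x in cell n, ‖g x‖ₑ) ^ r := by gcongr; exact hle n
      _ ≤ v n ^ r * ∫⁻ x in cell n, ‖g x‖ₑ ^ r := by
          rw [ENNReal.mul_rpow_of_nonneg _ _ hr0.le]
          gcongr
      _ = ∫⁻ x in cell n, (v n * ‖g x‖ₑ) ^ r := by
          rw [← lintegral_const_mul _ (by fun_prop)]
          simp_rw [ENNReal.mul_rpow_of_nonneg _ _ hr0.le]
      _ = ∫⁻ x in cell n, (vtilde v x * ‖g x‖ₑ) ^ r := by
          refine lintegral_congr_ae ?_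
          filter_upwards [ae_restrict_mem (measurableSet_cell _),
            ae_restrict_of_ae (vtilde_ae v)] with x hx hx'
          rw [hx', mem_cell.1 hx]

theorem wNormR_step_le {p : ℝ≥0∞} {v : ℤ → ℝ≥0∞} (hv : ∀ n, v (-n) = v n) (f : ℤ → ℂ) :
    wNormR (vtilde v) p (fun x => f (-round x)) ≤ seqNorm v p f := by
  by_cases hpt : p = ∞
  · simp only [seqNorm, wNormR, hpt, if_true, enn_eq_enorm]
    refine essSup_le_of_ae_le _ ?_
    filter_upwards [vtilde_ae v] with x hx
    rw [hx, ← hv]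
    exact le_iSup (fun n => v n * ‖f n‖ₑ) (-round x)
  · simp only [seqNorm, wNormR, hpt, if_false, enn_eq_enorm]
    gcongr
    rw [lintegral_eq_tsum_cell, ← (Equiv.neg ℤ).tsum_eq]
    refine ENNReal.tsum_le_tsum fun n => ?_
    calc ∫⁻ x in cell (Equiv.neg ℤ n), (vtilde v x * ‖f (-round x)‖ₑ) ^ p.toReal
        = ∫⁻ x in cell (-n), (v n * ‖f n‖ₑ) ^ p.toReal := by
          refine lintegral_congr_ae ?_
          filter_upwards [ae_restrict_mem (measurableSet_cell _),
            ae_restrict_of_ae (vtilde_ae v)] with x hx hx'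
          rw [hx', mem_cell.1 hx, Equiv.neg_apply, hv, neg_neg]
      _ ≤ (v n * ‖f n‖ₑ) ^ p.toReal := by
          rw [setLIntegral_const, volume_cell, mul_one]

/-- The moment densities in the expansion of `ĝ` around the centres of the cells. -/
def cellMoment (g : ℝ → ℂ) (k : ℕ) (x : ℝ) : ℂ := ((2 * (x - round x) : ℝ) : ℂ) ^ k * g x

theorem norm_cellMoment_le (g : ℝ → ℂ) (k : ℕ) (x : ℝ) : ‖cellMoment g k x‖ ≤ ‖g x‖ := by
  rw [cellMoment, norm_mul, norm_pow, Complex.norm_real, Real.norm_eq_abs, abs_mul]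
  refine mul_le_of_le_one_left (norm_nonneg _) (pow_le_one₀ (by positivity) ?_)
  have := abs_sub_round x
  rw [abs_two]
  linarith

theorem integrable_cellMoment {g : ℝ → ℂ} (hg : Integrable g) (k : ℕ) :
    Integrable (cellMoment g k) := by
  have hr := measurable_round_cast
  exact hg.mono (AEStronglyMeasurable.mul (by fun_prop) hg.1)
    (ae_of_all _ (norm_cellMoment_le g k))

theorem hasSum_FT1 {g : ℝ → ℂ} (hg : Integrable g) (ξ : ℝ) :
    HasSum (fun k : ℕ => ((((-Real.pi * ξ : ℝ) : ℂ) * Complex.I) ^ k / (k.factorial : ℂ)) *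
      FSeries (fun n => ∫ x in cell (-n), cellMoment g k x) ξ) (FT1 g ξ) := by
  have hr := measurable_round_cast
  set c : ℕ → ℂ := fun k => (((-Real.pi * ξ : ℝ) : ℂ) * Complex.I) ^ k / (k.factorial : ℂ)
  set e : ℝ → ℂ := fun x =>
    Complex.exp (((-2 * Real.pi * (round x * ξ) : ℝ) : ℂ) * Complex.I)
  have hi : ∀ k, Integrable fun x => c k * (e x * cellMoment g k x) := fun k =>
    (integrable_cexp_mul (φ := fun x => -2 * Real.pi * (round x * ξ)) (by fun_prop)
      (integrable_cellMoment hg k)).const_mul _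
  have hc : Summable fun k => ‖c k‖ := by
    refine (Real.summable_pow_div_factorial ‖((-Real.pi * ξ : ℝ) : ℂ) * Complex.I‖).congr
      fun k => ?_
    simp only [c, norm_div, norm_pow, Complex.norm_natCast]
  have hs : Summable fun k => ∫ x, ‖c k * (e x * cellMoment g k x)‖ := by
    refine (hc.mul_right (∫ x, ‖g x‖)).of_nonneg_of_le
      (fun k => integral_nonneg fun x => norm_nonneg _) fun k => ?_
    rw [← integral_const_mul]
    refine integral_mono (hi k).norm (hg.norm.const_mul _) fun x => ?_
    simp only [norm_mul (c k), e, norm_cexp_ofReal_mul_I_mul]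
    gcongr
    exact norm_cellMoment_le g k x
  have hcoef : ∀ k, ∫ x, c k * (e x * cellMoment g k x) =
      c k * FSeries (fun n => ∫ x in cell (-n), cellMoment g k x) ξ := fun k => by
    rw [integral_const_mul, FSeries_integral_cell (integrable_cellMoment hg k)]
  have hval : FT1 g ξ = ∫ x, ∑' k, c k * (e x * cellMoment g k x) := by
    refine integral_congr_ae (ae_of_all _ fun x => ?_)
    have hexp := NormedSpace.expSeries_div_hasSum_exp
      (((-2 * Real.pi * ((x - round x) * ξ) : ℝ) : ℂ) * Complex.I)
    rw [← Complex.exp_eq_exp_ℂ] at hexp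
    have h1 : Complex.exp (((-2 * Real.pi * (x * ξ) : ℝ) : ℂ) * Complex.I) =
        e x * Complex.exp (((-2 * Real.pi * ((x - round x) * ξ) : ℝ) : ℂ) * Complex.I) := by
      rw [← Complex.exp_add]
      congr 1
      push_cast
      ring
    dsimp only
    rw [h1, ← ((hexp.mul_left (e x)).mul_right (g x)).tsum_eq]
    refine tsum_congr fun k => ?_
    have h2 : ((-2 * Real.pi * ((x - round x) * ξ) : ℝ) : ℂ) * Complex.I =
        (((-Real.pi * ξ : ℝ) : ℂ) * Complex.I) * ((2 * (x - round x) : ℝ) : ℂ) := by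
      push_cast
      ring
    rw [h2, mul_pow]
    simp only [c, cellMoment]
    ring
  have hsum := hasSum_integral_of_summable_integral_norm hi hs
  simp only [hcoef] at hsum
  rw [hval]
  exact hsum

theorem enorm_FT1_le {g : ℝ → ℂ} (hg : Integrable g) {ξ : ℝ}
    (hξ : ξ ∈ Icc (-(1/2) : ℝ) (1/2)) :
    ‖FT1 g ξ‖ₑ ≤ ENNReal.ofReal (Real.exp (2 * Real.pi)) *
      ∑' k, 4⁻¹ ^ k * ‖FSeries (fun n => ∫ x in cell (-n), cellMoment g k x) ξ‖ₑ := by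
  rw [← (hasSum_FT1 hg ξ).tsum_eq, ← ENNReal.tsum_mul_left]
  refine enorm_tsum_le_tsum_enorm.trans (ENNReal.tsum_le_tsum fun k => ?_)
  rw [enorm_mul, ← mul_assoc]
  gcongr
  have h4 : (4⁻¹ : ℝ≥0∞) ^ k = ENNReal.ofReal ((4⁻¹ : ℝ) ^ k) := by
    rw [ENNReal.ofReal_pow (by norm_num), ENNReal.ofReal_inv_of_pos (by norm_num)]
    norm_num
  rw [h4, ← ENNReal.ofReal_mul (Real.exp_pos _).le, ← ofReal_norm]
  refine ENNReal.ofReal_le_ofReal ?_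
  rw [norm_div, norm_pow, norm_mul, Complex.norm_I, mul_one, Complex.norm_real,
    Complex.norm_natCast, Real.norm_eq_abs, abs_mul, abs_neg, abs_of_pos Real.pi_pos]
  have hξ' : |ξ| ≤ 1 / 2 := abs_le.2 hξ
  calc (Real.pi * |ξ|) ^ k / (k.factorial : ℝ)
      ≤ (2 * Real.pi * 4⁻¹) ^ k / (k.factorial : ℝ) := by
        refine div_le_div_of_nonneg_right (pow_le_pow_left₀ (by positivity) ?_ k) (by positivity)
        nlinarith [Real.pi_pos]
    _ = (2 * Real.pi) ^ k / (k.factorial : ℝ) * 4⁻¹ ^ k := by rw [mul_pow]; ring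
    _ ≤ Real.exp (2 * Real.pi) * 4⁻¹ ^ k := by
        gcongr
        exact Real.pow_div_factorial_le_exp _ (by positivity) k

theorem integral_cell_cexp (n : ℤ) (ξ : ℝ) :
    ∫ x in cell n, Complex.exp (((-2 * Real.pi * ((x - round x) * ξ) : ℝ) : ℂ) * Complex.I) =
      ∫ t in (-(1/2) : ℝ)..(1/2),
        Complex.exp (((-2 * Real.pi * (t * ξ) : ℝ) : ℂ) * Complex.I) := by
  rw [setIntegral_congr_fun (g := fun x : ℝ =>
    Complex.exp (((-2 * Real.pi * ((x - n) * ξ) : ℝ) : ℂ) * Complex.I)) (measurableSet_cell n)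
    fun x hx => by dsimp only; rw [mem_cell.1 hx]]
  rw [cell, integral_Ico_eq_integral_Ioc, ← intervalIntegral.integral_of_le (by linarith),
    intervalIntegral.integral_comp_sub_right (fun t : ℝ =>
      Complex.exp (((-2 * Real.pi * (t * ξ) : ℝ) : ℂ) * Complex.I)) (n : ℝ)]
  congr 1 <;> ring

theorem half_le_norm_integral_cexp {ξ : ℝ} (hξ : ξ ∈ Icc (-(1/2) : ℝ) (1/2)) :
    1 / 2 ≤ ‖∫ t in (-(1/2) : ℝ)..(1/2),
      Complex.exp (((-2 * Real.pi * (t * ξ) : ℝ) : ℂ) * Complex.I)‖ := by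
  refine le_trans ?_ (Complex.re_le_norm _)
  have hI : IntervalIntegrable (fun t : ℝ =>
      Complex.exp (((-2 * Real.pi * (t * ξ) : ℝ) : ℂ) * Complex.I)) volume (-(1/2)) (1/2) :=
    Continuous.intervalIntegrable (by fun_prop) _ _
  have hre := Complex.reCLM.intervalIntegral_comp_comm hI
  simp only [Complex.reCLM_apply, Complex.exp_ofReal_mul_I_re] at hre
  rw [← hre]
  have hπ : Real.pi ^ 2 ≤ 12 := by nlinarith [Real.pi_pos, Real.pi_lt_d2]
  calc (1 / 2 : ℝ) ≤ ∫ t in (-(1/2) : ℝ)..(1/2), (1 - 6 * t ^ 2) := by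
        rw [intervalIntegral.integral_sub (by simp)
          (Continuous.intervalIntegrable (by fun_prop) _ _)]
        simp only [intervalIntegral.integral_const_mul, integral_pow, intervalIntegral.integral_const]
        norm_num
    _ ≤ _ := by
        refine intervalIntegral.integral_mono_on (by norm_num)
          (Continuous.intervalIntegrable (by fun_prop) _ _)
          (Continuous.intervalIntegrable (by fun_prop) _ _) fun t _ => ?_
        refine le_trans ?_ Real.one_sub_sq_div_two_le_cos
        have hξ2 : ξ ^ 2 ≤ 1 / 4 := by nlinarith [hξ.1, hξ.2]
        have h1 : Real.pi ^ 2 * ξ ^ 2 ≤ 12 * (1 / 4) :=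
          mul_le_mul hπ hξ2 (sq_nonneg _) (by norm_num)
        nlinarith [mul_le_mul_of_nonneg_right h1 (sq_nonneg t)]

theorem integrable_step {f : ℤ → ℂ} (hf : Summable fun n => ‖f n‖) :
    Integrable fun x : ℝ => f (-round x) := by
  have hm : Measurable fun x : ℝ => f (-round x) :=
    (measurable_from_top (f := fun n : ℤ => f (-n))).comp measurable_round_real
  refine ⟨hm.aestronglyMeasurable, ?_⟩
  rw [HasFiniteIntegral, lintegral_eq_tsum_cell]
  have : ∀ n, ∫⁻ x in cell n, ‖f (-round x)‖ₑ = ‖f (-n)‖ₑ := fun n => by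
    rw [setLIntegral_congr_fun (g := fun _ => ‖f (-n)‖ₑ) (measurableSet_cell n)
      fun x hx => by dsimp only; rw [mem_cell.1 hx], setLIntegral_const, volume_cell, mul_one]
  simp_rw [this]
  refine ((Equiv.neg ℤ).tsum_eq fun n => ‖f n‖ₑ).trans_lt ?_
  simp_rw [← ofReal_norm]
  exact hf.tsum_ofReal_lt_top

theorem FT1_step {f : ℤ → ℂ} (hf : Summable fun n => ‖f n‖) (ξ : ℝ) :
    FT1 (fun x => f (-round x)) ξ = FSeries f ξ * ∫ t in (-(1/2) : ℝ)..(1/2),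
      Complex.exp (((-2 * Real.pi * (t * ξ) : ℝ) : ℂ) * Complex.I) := by
  have hr := measurable_round_cast
  have hi := integrable_cexp_mul (φ := fun x => -2 * Real.pi * ((x - round x) * ξ)) (by fun_prop)
    (integrable_step hf)
  calc FT1 (fun x => f (-round x)) ξ
      = ∫ x : ℝ, Complex.exp (((-2 * Real.pi * (round x * ξ) : ℝ) : ℂ) * Complex.I) *
          (Complex.exp (((-2 * Real.pi * ((x - round x) * ξ) : ℝ) : ℂ) * Complex.I) *
            f (-round x)) := by
        refine integral_congr_ae (ae_of_all _ fun x => ?_)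
        dsimp only
        rw [← mul_assoc (Complex.exp _), ← Complex.exp_add]
        congr 2
        push_cast
        ring
    _ = _ := by
        rw [← FSeries_integral_cell hi, FSeries, FSeries, ← tsum_mul_right]
        refine tsum_congr fun n => ?_
        rw [setIntegral_congr_fun (g := fun x : ℝ =>
          Complex.exp (((-2 * Real.pi * ((x - round x) * ξ) : ℝ) : ℂ) * Complex.I) * f n)
          (measurableSet_cell _) fun x hx => by dsimp only; rw [mem_cell.1 hx, neg_neg],
          integral_mul_const, integral_cell_cexp]
        ring

theorem halfNorm_le_mul_of_enorm_le {u : ℝ → ℝ≥0∞} {q : ℝ≥0∞} (hq : 0 < q) {K : ℝ≥0∞}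
    (hK : K ≠ ∞) {F G : ℝ → ℂ}
    (h : ∀ ξ ∈ Icc (-(1/2) : ℝ) (1/2), ‖F ξ‖ₑ ≤ K * ‖G ξ‖ₑ) :
    halfNorm u q F ≤ K * halfNorm u q G := by
  have hu : ∀ ξ ∈ Icc (-(1/2) : ℝ) (1/2), u ξ * ‖F ξ‖ₑ ≤ K * (u ξ * ‖G ξ‖ₑ) := fun ξ hξ => by
    rw [mul_left_comm]
    gcongr
    exact h ξ hξ
  by_cases hqt : q = ∞
  · simp only [halfNorm, hqt, if_true, enn_eq_enorm]
    rw [← ENNReal.essSup_const_mul]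
    refine essSup_mono_ae ?_
    filter_upwards [ae_restrict_mem measurableSet_Icc] with x hx using hu x hx
  · have hr0 : 0 < q.toReal := ENNReal.toReal_pos hq.ne' hqt
    simp only [halfNorm, hqt, if_false, enn_eq_enorm]
    rw [one_div q.toReal, ENNReal.rpow_inv_le_iff hr0, ENNReal.mul_rpow_of_nonneg _ _ hr0.le,
      ENNReal.rpow_inv_rpow hr0.ne', ← lintegral_const_mul' _ _ (by finiteness)]
    refine setLIntegral_mono' measurableSet_Icc fun x hx => ?_
    rw [← ENNReal.mul_rpow_of_nonneg _ _ hr0.le]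
    exact ENNReal.rpow_le_rpow (hu x hx) hr0.le

theorem enorm_FSeries_le {f : ℤ → ℂ} (hf : Summable fun n => ‖f n‖) {ξ : ℝ}
    (hξ : ξ ∈ Icc (-(1/2) : ℝ) (1/2)) :
    ‖FSeries f ξ‖ₑ ≤ 2 * ‖FT1 (fun x => f (-round x)) ξ‖ₑ := by
  have h : ‖FSeries f ξ‖ ≤ 2 * ‖FT1 (fun x => f (-round x)) ξ‖ := by
    rw [FT1_step hf, norm_mul]
    nlinarith [half_le_norm_integral_cexp hξ, norm_nonneg (FSeries f ξ)]
  have := ENNReal.ofReal_le_ofReal h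
  rwa [ENNReal.ofReal_mul zero_le_two, ofReal_norm, ofReal_norm, ENNReal.ofReal_ofNat] at this

/-- For even monotone weights, the best constants in the weighted
inequalities for Fourier series and for the Fourier transform with the step weight `ṽ`
are comparable, with constants depending only on `p` and `q`. -/
theorem statement17 (p q : ℝ≥0∞) (hp : 1 ≤ p) (hq : 0 < q) :
    ∃ K : ℝ≥0∞, 0 < K ∧ K < ∞ ∧
      ∀ (u : ℝ → ℝ≥0∞) (v : ℤ → ℝ≥0∞),
        (∃ u₀ : ℝ → ℝ≥0∞, AntitoneOn u₀ (Ici 0) ∧ ∀ x, u x = u₀ |x|) →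
        (∀ n, 0 < v n) → (∀ n, v (-n) = v n) → (∀ m n : ℤ, |m| ≤ |n| → v m ≤ v n) →
        ∀ C : ℝ≥0∞,
          ((∀ f : ℤ → ℂ, Summable (fun n => ‖f n‖) →
              halfNorm u q (FSeries f) ≤ C * seqNorm v p f) →
            ∀ g : ℝ → ℂ, Measurable g → Integrable g →
              halfNorm u q (FT1 g) ≤ K * C * wNormR (vtilde v) p g) ∧
          ((∀ g : ℝ → ℂ, Measurable g → Integrable g →
              halfNorm u q (FT1 g) ≤ C * wNormR (vtilde v) p g) →
            ∀ f : ℤ → ℂ, Summable (fun n => ‖f n‖) →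
              halfNorm u q (FSeries f) ≤ K * C * seqNorm v p f) := by
  obtain ⟨K, hK, hser⟩ :=
    exists_halfNorm_series_bound hq (M := ENNReal.ofReal (Real.exp (2 * Real.pi))) (by simp)
  refine ⟨K + 2, by simp, by finiteness, ?_⟩
  rintro u v ⟨u₀, hu₀, hu⟩ - hv - C
  refine ⟨fun H g hgm hg => ?_, fun H f hf => ?_⟩
  · have hsum : ∀ k, Summable fun n : ℤ => ‖∫ x in cell (-n), cellMoment g k x‖ := fun k =>
      (Equiv.neg ℤ).summable_iff.2 (summable_norm_integral_cell (integrable_cellMoment hg k))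
    calc halfNorm u q (FT1 g) ≤ K * (C * wNormR (vtilde v) p g) :=
          hser u _ (fun k => FSeries fun n => ∫ x in cell (-n), cellMoment g k x) _
            (measurable_of_even_antitoneOn hu₀ hu) (fun k => measurable_FSeries (hsum k))
            (fun ξ hξ => enorm_FT1_le hg hξ) fun k => (H _ (hsum k)).trans (by
              gcongr
              exact seqNorm_integral_cell_le hp hv hgm (norm_cellMoment_le g k))
      _ ≤ (K + 2) * C * wNormR (vtilde v) p g := by
          rw [← mul_assoc]
          gcongr
          exact le_self_add
  · have hm : Measurable fun x : ℝ => f (-round x) :=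
      (measurable_from_top (f := fun n : ℤ => f (-n))).comp measurable_round_real
    calc halfNorm u q (FSeries f) ≤ 2 * halfNorm u q (FT1 fun x => f (-round x)) :=
          halfNorm_le_mul_of_enorm_le hq (by simp) fun ξ hξ => enorm_FSeries_le hf hξ
      _ ≤ 2 * (C * seqNorm v p f) := by
          gcongr
          refine (H _ hm (integrable_step hf)).trans ?_
          gcongr
          exact wNormR_step_le hv f
      _ ≤ (K + 2) * C * seqNorm v p f := by
          rw [← mul_assoc]
          gcongr
          exact le_add_self
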